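/- arXiv:1711.01057 — 3 statements merged into one kernel-verified Lean document; each statement's English description precedes it below -/
import Mathlib

section
/- Let (W,S) be a right-angled Coxeter system, and let w = s₁⋯s_k t_{k+1}⋯t_ℓ be a reduced word such that the prefix s₁⋯s_k represents a firm element of W of length k and such that F#(w) = k. Then s_k commutes with t_i in W for all i ∈ {k+1, …, ℓ}. -/
/-- A Coxeter matrix is *right-angled* if all of its off-diagonal entries are equal to `2`
or to `0` (where `0` encodes `∞`, i.e. no relation). -/
def CoxeterMatrix.IsRightAngled {B : Type*} (M : CoxeterMatrix B) : Prop :=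
  ∀ i j : B, i ≠ j → M i j = 2 ∨ M i j = 0

/-- An element `w` of a Coxeter group is *firm* if there is a unique simple generator `r`
with `ℓ(w r) < ℓ(w)`.  (This forces `ℓ(w) ≥ 1`.) -/
def CoxeterSystem.IsFirm {B W : Type*} [Group W] {M : CoxeterMatrix B}
    (cs : CoxeterSystem M W) (w : W) : Prop :=
  ∃! r : B, cs.length (w * cs.simple r) < cs.length w

/-- The *firmness* `F#(w)` of an element `w` of a Coxeter group: the largest `k` such that
`w` admits a reduced representation whose prefix of length `k` represents a firm element
(of length `k`, automatically).  By convention `F#(1) = 0` (the case `k = 0`). -/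
noncomputable def CoxeterSystem.firmness {B W : Type*} [Group W] {M : CoxeterMatrix B}
    (cs : CoxeterSystem M W) (w : W) : ℕ :=
  sSup {k | ∃ ω : List B, cs.IsReduced ω ∧ cs.wordProd ω = w ∧ k ≤ ω.length ∧
    (k = 0 ∨ cs.IsFirm (cs.wordProd (ω.take k)))}

namespace CoxeterMatrix

variable {B : Type*} (M : CoxeterMatrix B)

/-- The letter `r` occurs in the word and commutes past all letters preceding its first
occurrence. -/
def MovesToFront (r : B) : List B → Prop
  | [] => False
  | i :: l => i = r ∨ (M i r = 2 ∧ MovesToFront r l)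

/-- No letter of the word can be cancelled against a later one by commutations. -/
def Irredundant : List B → Prop
  | [] => True
  | i :: l => ¬ M.MovesToFront i l ∧ Irredundant l

/-- Equivalence of words up to swapping adjacent commuting letters. -/
inductive CommEquiv : List B → List B → Prop
  | refl (l) : CommEquiv l l
  | cons (i) {l l'} : CommEquiv l l' → CommEquiv (i :: l) (i :: l')
  | swap {i j} (l) : M i j = 2 → CommEquiv (i :: j :: l) (j :: i :: l)
  | trans {l₁ l₂ l₃} : CommEquiv l₁ l₂ → CommEquiv l₂ l₃ → CommEquiv l₁ l₃

variable {M}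

theorem ne_of_eq_two {i j : B} (h : M i j = 2) : i ≠ j := by
  rintro rfl
  simp at h

theorem CommEquiv.symm {l l' : List B} (h : M.CommEquiv l l') : M.CommEquiv l' l := by
  induction h with
  | refl l => exact .refl l
  | cons i _ ih => exact .cons i ih
  | swap l h => exact .swap l (by rwa [M.symmetric])
  | trans _ _ ih₁ ih₂ => exact ih₂.trans ih₁

theorem CommEquiv.movesToFront_iff {l l' : List B} (h : M.CommEquiv l l') (r : B) :
    M.MovesToFront r l ↔ M.MovesToFront r l' := by
  induction h with
  | refl l => rfl
  | cons i _ ih => simp only [MovesToFront, ih]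
  | @swap i j l h =>
    have h' : M j i = 2 := by rwa [M.symmetric]
    simp only [MovesToFront]
    grind
  | trans _ _ ih₁ ih₂ => exact ih₁.trans ih₂

theorem movesToFront_cons_iff {i j : B} (h : M i j = 2) (l : List B) :
    M.MovesToFront i (j :: l) ↔ M.MovesToFront i l := by
  have h' : M j i = 2 := by rwa [M.symmetric]
  simp [MovesToFront, h', ne_of_eq_two h']

theorem CommEquiv.irredundant_iff {l l' : List B} (h : M.CommEquiv l l') :
    M.Irredundant l ↔ M.Irredundant l' := by
  induction h with
  | refl l => rfl
  | cons i h ih => simp only [Irredundant, ih, h.movesToFront_iff]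
  | @swap i j l h =>
    have h' : M j i = 2 := by rwa [M.symmetric]
    simp only [Irredundant, movesToFront_cons_iff h, movesToFront_cons_iff h']
    tauto
  | trans _ _ ih₁ ih₂ => exact ih₁.trans ih₂

theorem MovesToFront.exists_eq_append {r : B} {l : List B} (h : M.MovesToFront r l) :
    ∃ a b, l = a ++ r :: b ∧ ∀ i ∈ a, M i r = 2 := by
  induction l with
  | nil => exact h.elim
  | cons i l ih =>
    obtain rfl | ⟨hi, h⟩ := h
    · exact ⟨[], l, rfl, by simp⟩
    · obtain ⟨a, b, rfl, hab⟩ := ih h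
      exact ⟨i :: a, b, rfl, by simpa [hi] using hab⟩

open Classical in
theorem CommEquiv.erase {l l' : List B} (h : M.CommEquiv l l') (r : B) :
    M.CommEquiv (l.erase r) (l'.erase r) := by
  induction h with
  | refl l => exact .refl _
  | @cons i l l' h ih =>
    by_cases hi : i = r
    · simpa [hi] using h
    · simpa [hi] using ih.cons i
  | @swap i j l h =>
    have hij := ne_of_eq_two h
    by_cases hi : i = r
    · subst hi
      simpa [hij.symm] using .refl _
    · by_cases hj : j = r
      · subst hj
        simpa [hij] using .refl _
      · simpa [hi, hj] using .swap _ h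
  | trans _ _ ih₁ ih₂ => exact ih₁.trans ih₂

open Classical in
theorem MovesToFront.commEquiv {r : B} {l : List B} (h : M.MovesToFront r l) :
    M.CommEquiv l (r :: l.erase r) := by
  induction l with
  | nil => exact h.elim
  | cons i l ih =>
    obtain rfl | ⟨hi, h⟩ := h
    · simpa using .refl _
    · have hne := ne_of_eq_two hi
      simpa [hne] using ((ih h).cons i).trans (.swap _ hi)

open Classical in
theorem movesToFront_erase_iff {i j : B} (h : M i j = 2) {l : List B}
    (hj : M.MovesToFront j l) : M.MovesToFront i (l.erase j) ↔ M.MovesToFront i l := by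
  rw [hj.commEquiv.movesToFront_iff, movesToFront_cons_iff h]

open Classical in
/-- Left multiplication of a word by the letter `r`, cancelling if possible. -/
noncomputable def mulLetter (M : CoxeterMatrix B) (r : B) (l : List B) : List B :=
  if M.MovesToFront r l then l.erase r else r :: l

theorem Irredundant.mulLetter {l : List B} (h : M.Irredundant l) (r : B) :
    M.Irredundant (M.mulLetter r l) := by
  unfold CoxeterMatrix.mulLetter
  split_ifs with hr
  · exact (hr.commEquiv.irredundant_iff.1 h).2
  · exact ⟨hr, h⟩

theorem CommEquiv.mulLetter {l l' : List B} (h : M.CommEquiv l l') (r : B) :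
    M.CommEquiv (M.mulLetter r l) (M.mulLetter r l') := by
  unfold CoxeterMatrix.mulLetter
  rw [h.movesToFront_iff]
  split_ifs
  · exact h.erase r
  · exact h.cons r

theorem Irredundant.mulLetter_mulLetter_self {l : List B} (h : M.Irredundant l) (r : B) :
    M.CommEquiv (M.mulLetter r (M.mulLetter r l)) l := by
  by_cases hr : M.MovesToFront r l
  · have hr' := (hr.commEquiv.irredundant_iff.1 h).1
    simpa [CoxeterMatrix.mulLetter, hr, hr'] using hr.commEquiv.symm
  · simpa [CoxeterMatrix.mulLetter, hr, MovesToFront] using .refl l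

theorem movesToFront_mulLetter_iff {i j : B} (h : M i j = 2) (l : List B) :
    M.MovesToFront i (M.mulLetter j l) ↔ M.MovesToFront i l := by
  unfold mulLetter
  split_ifs with hj
  · exact movesToFront_erase_iff h hj
  · exact movesToFront_cons_iff h l

theorem mulLetter_comm {i j : B} (h : M i j = 2) (l : List B) :
    M.CommEquiv (M.mulLetter i (M.mulLetter j l)) (M.mulLetter j (M.mulLetter i l)) := by
  classical
  have h' : M j i = 2 := by rwa [M.symmetric]
  have hne := ne_of_eq_two h
  have e₁ := movesToFront_mulLetter_iff h l
  have e₂ := movesToFront_mulLetter_iff h' l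
  rw [mulLetter, mulLetter.eq_1 M j (M.mulLetter i l)]
  simp only [e₁, e₂]
  unfold mulLetter
  by_cases hi : M.MovesToFront i l <;> by_cases hj : M.MovesToFront j l
  · simpa [hi, hj, List.erase_comm i j] using .refl _
  · simpa [hi, hj, hne, hne.symm] using .refl _
  · simpa [hi, hj, hne, hne.symm] using .refl _
  · simpa [hi, hj] using .swap l h

variable (M) in
/-- Irredundant words up to commutation. -/
def irredundantSetoid : Setoid {l : List B // M.Irredundant l} where
  r l l' := M.CommEquiv l l'
  iseqv := ⟨fun _ ↦ .refl _, fun h ↦ h.symm, fun h h' ↦ h.trans h'⟩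

variable (M) in
/-- The action of a letter on the irredundant words up to commutation. -/
noncomputable def letterEnd (r : B) : Function.End (Quotient M.irredundantSetoid) :=
  Quotient.map (fun l ↦ ⟨M.mulLetter r l, l.2.mulLetter r⟩)
    fun _ _ h ↦ CommEquiv.mulLetter h r

theorem letterEnd_mul_self (r : B) : M.letterEnd r * M.letterEnd r = 1 := by
  funext x
  induction x using Quotient.inductionOn with
  | h l => exact Quotient.sound (l.2.mulLetter_mulLetter_self r)

theorem letterEnd_comm {i j : B} (h : M i j = 2) :
    M.letterEnd i * M.letterEnd j = M.letterEnd j * M.letterEnd i := by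
  funext x
  induction x using Quotient.inductionOn with
  | h l => exact Quotient.sound (mulLetter_comm h l.1)

theorem IsRightAngled.isLiftable_letterEnd (hM : M.IsRightAngled) :
    M.IsLiftable M.letterEnd := by
  intro i j
  by_cases hij : i = j
  · subst hij
    simp [letterEnd_mul_self]
  obtain h | h := hM i j hij
  · rw [h, pow_two]
    nth_rw 2 [letterEnd_comm h]
    rw [mul_assoc, ← mul_assoc (M.letterEnd j), letterEnd_mul_self, one_mul, letterEnd_mul_self]
  · rw [h, pow_zero]

end CoxeterMatrix

namespace CoxeterSystem

open CoxeterMatrix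

variable {B W : Type*} [Group W] {M : CoxeterMatrix B} (cs : CoxeterSystem M W)

theorem simple_comm_of_eq_two {i j : B} (h : M i j = 2) : Commute (cs.simple i) (cs.simple j) := by
  have h2 := cs.simple_mul_simple_pow i j
  rw [h, pow_two] at h2
  have := eq_inv_of_mul_eq_one_left h2
  simpa [Commute, SemiconjBy] using this

theorem wordProd_eq_of_commEquiv {l l' : List B} (h : M.CommEquiv l l') :
    cs.wordProd l = cs.wordProd l' := by
  induction h with
  | refl l => rfl
  | cons i _ ih => rw [wordProd_cons, wordProd_cons, ih]
  | swap l h =>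
    simp only [wordProd_cons, ← mul_assoc, (cs.simple_comm_of_eq_two h).eq]
  | trans _ _ ih₁ ih₂ => exact ih₁.trans ih₂

variable {cs} in
theorem IsReduced.irredundant {l : List B} (h : cs.IsReduced l) : M.Irredundant l := by
  classical
  induction l with
  | nil => trivial
  | cons i l ih =>
    refine ⟨fun hi ↦ ?_, ih (by simpa using h.drop 1)⟩
    have e : cs.wordProd (i :: l) = cs.wordProd (l.erase i) := by
      rw [wordProd_cons, cs.wordProd_eq_of_commEquiv hi.commEquiv, wordProd_cons,
        simple_mul_simple_cancel_left]
    have h1 := cs.length_wordProd_le (l.erase i)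
    have h2 := (l.erase_sublist (a := i)).length_le
    rw [← e, h.eq, List.length_cons] at h1
    omega

theorem lift_letterEnd_wordProd (hM : M.IsRightAngled) {l : List B} (h : M.Irredundant l) :
    cs.lift ⟨M.letterEnd, hM.isLiftable_letterEnd⟩ (cs.wordProd l)
      (Quotient.mk M.irredundantSetoid ⟨[], trivial⟩) =
      Quotient.mk M.irredundantSetoid ⟨l, h⟩ := by
  induction l with
  | nil => simp; rfl
  | cons i l ih =>
    rw [wordProd_cons, map_mul, lift_apply_simple]
    refine (congrArg (M.letterEnd i) (ih h.2)).trans (congrArg (Quotient.mk _) (Subtype.ext ?_))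
    simp [mulLetter, h.1]

theorem commEquiv_of_wordProd_eq (hM : M.IsRightAngled) {l l' : List B} (hl : M.Irredundant l)
    (hl' : M.Irredundant l') (h : cs.wordProd l = cs.wordProd l') : M.CommEquiv l l' := by
  have e := cs.lift_letterEnd_wordProd hM hl
  rw [h, cs.lift_letterEnd_wordProd hM hl'] at e
  exact (Quotient.exact e : M.CommEquiv l' l).symm

variable {cs} in
theorem IsReduced.movesToFront_of_isLeftDescent (hM : M.IsRightAngled) {l : List B}
    (hl : cs.IsReduced l) {r : B} (hr : cs.IsLeftDescent (cs.wordProd l) r) :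
    M.MovesToFront r l := by
  obtain ⟨l', hl', e⟩ := cs.exists_isReduced (cs.simple r * cs.wordProd l)
  have e' : cs.wordProd (r :: l') = cs.wordProd l := by
    rw [wordProd_cons, ← e, simple_mul_simple_cancel_left]
  have hred : cs.IsReduced (r :: l') := by
    rw [IsReduced, e', List.length_cons, ← hl'.eq, ← e]
    exact (cs.isLeftDescent_iff.1 hr).symm
  exact ((cs.commEquiv_of_wordProd_eq hM hred.irredundant hl.irredundant e').movesToFront_iff r).1
    (.inl rfl)

variable {cs} in
theorem IsReduced.exists_eq_append_of_isRightDescent (hM : M.IsRightAngled) {l : List B} {t r : B}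
    (hl : cs.IsReduced (l ++ [t])) (hr : cs.IsRightDescent (cs.wordProd (l ++ [t])) r)
    (hrt : r ≠ t) : ∃ a b, l = a ++ r :: b ∧ (∀ i ∈ b, M i r = 2) ∧ M t r = 2 := by
  have h : M.MovesToFront r (l ++ [t]).reverse := by
    refine hl.reverse.movesToFront_of_isLeftDescent hM ?_
    rwa [wordProd_reverse, isLeftDescent_inv_iff]
  rw [List.reverse_append] at h
  obtain rfl | ⟨ht, h⟩ := h
  · exact (hrt rfl).elim
  · obtain ⟨a, b, e, hab⟩ := MovesToFront.exists_eq_append h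
    refine ⟨b.reverse, a.reverse, ?_, by simpa using hab, ht⟩
    simpa using congrArg List.reverse e

theorem commute_wordProd {r : B} {l : List B} (h : ∀ i ∈ l, M i r = 2) :
    Commute (cs.simple r) (cs.wordProd l) := by
  refine Commute.list_prod_right _ _ fun x hx ↦ ?_
  obtain ⟨i, hi, rfl⟩ := List.mem_map.1 hx
  exact (cs.simple_comm_of_eq_two (h i hi)).symm

variable {cs} in
theorem IsReduced.isRightDescent_of_append_cons {a b : List B} {r : B}
    (h : cs.IsReduced (a ++ r :: b)) (hb : ∀ i ∈ b, M i r = 2) :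
    cs.IsRightDescent (cs.wordProd (a ++ r :: b)) r := by
  have e : cs.wordProd (a ++ r :: b) * cs.simple r = cs.wordProd (a ++ b) := by
    rw [wordProd_append, wordProd_cons, (cs.commute_wordProd hb).eq, wordProd_append]
    simp [mul_assoc]
  have := cs.length_wordProd_le (a ++ b)
  rw [IsRightDescent, e, h.eq]
  simp only [List.length_append, List.length_cons] at this ⊢
  omega

theorem le_firmness {l : List B} (hl : cs.IsReduced l) {k : ℕ} (hk : k ≤ l.length)
    (hfirm : cs.IsFirm (cs.wordProd (l.take k))) : k ≤ cs.firmness (cs.wordProd l) := by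
  refine le_csSup ⟨cs.length (cs.wordProd l), ?_⟩ ⟨l, hl, rfl, hk, .inr hfirm⟩
  rintro m ⟨l', hl', e, hm, -⟩
  rwa [← e, hl'.eq]

/-- If a letter after the firm prefix `u` fails to commute with the last letter of `u`, then the
firmness exceeds the length of `u`. -/
theorem length_lt_firmness (hM : M.IsRightAngled) {u : List B} (hu : u ≠ [])
    (hfirm : cs.IsFirm (cs.wordProd u)) (x : List B) (t : B) (y : List B)
    (hred : cs.IsReduced (u ++ x ++ t :: y))
    (ht : ¬ Commute (cs.simple (u.getLast hu)) (cs.simple t)) :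
    u.length < cs.firmness (cs.wordProd (u ++ x ++ t :: y)) := by
  induction hn : x.length using Nat.strong_induction_on generalizing x y with
  | _ n ih =>
  subst hn
  have htake : (u ++ x ++ t :: y).take (u.length + x.length + 1) = u ++ x ++ [t] := by
    rw [show u.length + x.length + 1 = (u ++ x).length + 1 by simp, List.take_length_add_append]
    simp
  have hpre : cs.IsReduced (u ++ x ++ [t]) := htake ▸ hred.take _
  have hured : cs.IsReduced u := by simpa using hred.take u.length
  by_cases hf : cs.IsFirm (cs.wordProd (u ++ x ++ [t]))
  · have := cs.le_firmness hred (k := u.length + x.length + 1) (by simp) (htake ▸ hf)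
    omega
  obtain ⟨r, hr, hrt⟩ : ∃ r, cs.IsRightDescent (cs.wordProd (u ++ x ++ [t])) r ∧ r ≠ t := by
    by_contra! h
    exact hf ⟨t, hpre.isRightDescent_of_append_cons (by simp), h⟩
  obtain ⟨a, b, e, hb, htr⟩ := hpre.exists_eq_append_of_isRightDescent hM hr hrt
  have hshort : ∀ a', x = a' ++ r :: b →
      u.length < cs.firmness (cs.wordProd (u ++ x ++ t :: y)) := by
    rintro a' rfl
    have hc := cs.commute_wordProd (r := r) (l := b ++ [t])
      (by simpa [or_imp, forall_and] using ⟨hb, htr⟩)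
    have e' : cs.wordProd (u ++ (a' ++ r :: b) ++ t :: y) =
        cs.wordProd (u ++ (a' ++ b) ++ t :: (r :: y)) := by
      have hc' := congrArg (· * cs.wordProd y) hc.eq
      simp only [wordProd_append, wordProd_cons, wordProd_nil, mul_one, mul_assoc] at hc' ⊢
      rw [hc']
    rw [e']
    refine ih _ (by simp) _ _ ?_ rfl
    rw [IsReduced, ← e', hred.eq]
    simp
    omega
  obtain ⟨a', -, hx⟩ | ⟨c, huc, hc⟩ := List.append_eq_append_iff.1 e
  · exact hshort a' hx
  cases c with
  | nil => exact hshort [] (by simpa using hc.symm)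
  | cons i c =>
    obtain ⟨rfl, rfl⟩ := List.cons.inj hc
    have hr' : cs.IsRightDescent (cs.wordProd u) r := by
      rw [huc] at hured ⊢
      exact hured.isRightDescent_of_append_cons fun i hi ↦ hb i (by simp [hi])
    have hs : cs.IsRightDescent (cs.wordProd u) (u.getLast hu) := by
      have h := List.dropLast_append_getLast hu
      rw [← h] at hured
      have := hured.isRightDescent_of_append_cons (by simp)
      rwa [h] at this
    rw [hfirm.unique hs hr'] at ht
    exact (ht (cs.simple_comm_of_eq_two htr).symm).elim

end CoxeterSystem

/-- Lemma 2.11(i): if `u ++ v` is reduced, `u` represents a firm element and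
`F#(u ++ v) = |u|`, then the last letter of `u` commutes with every letter of `v`. -/
theorem lastLetter_comm_of_firm_prefix {B W : Type*} [Group W] {M : CoxeterMatrix B}
    (cs : CoxeterSystem M W) (hra : M.IsRightAngled)
    (u v : List B) (hred : cs.IsReduced (u ++ v))
    (hfirm : cs.IsFirm (cs.wordProd u))
    (hF : cs.firmness (cs.wordProd (u ++ v)) = u.length)
    (hu : u ≠ []) :
    ∀ t ∈ v, cs.simple (u.getLast hu) * cs.simple t
      = cs.simple t * cs.simple (u.getLast hu) := by
  intro t ht
  by_contra hne
  obtain ⟨x, y, rfl⟩ := List.append_of_mem ht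
  rw [← List.append_assoc] at hred hF
  exact (cs.length_lt_firmness hra hu hfirm x t y hred hne).ne' hF
end

section
/- Let (W,S) be a right-angled Coxeter system with S finite and let w ∈ W. Then there exists k(w) ∈ ℕ, depending only on w (and on (W,S)), such that for every reduced increasing w-sequence (r₁, r₂, …, r_{k(w)}) in S one has F#(w r₁⋯r_{k(w)}) > F#(w). -/
namespace CoxeterSystem

variable {B W : Type*} [Group W] {M : CoxeterMatrix B}

theorem _root_.CoxeterMatrix.IsRightAngled.isLiftable (hra : M.IsRightAngled) {G : Type*} [Monoid G]
    {f : B → G} (hsq : ∀ i, f i * f i = 1) (hcomm : ∀ i j, M i j = 2 → f i * f j = f j * f i) :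
    M.IsLiftable f := by
  intro i j
  by_cases hij : i = j
  · subst hij
    simp [hsq]
  · rcases hra i j hij with h | h
    · rw [h, pow_two]
      calc f i * f j * (f i * f j) = f j * f i * (f i * f j) := by rw [hcomm i j h]
        _ = f j * (f i * f i) * f j := by simp only [mul_assoc]
        _ = 1 := by rw [hsq, mul_one, hsq]
    · rw [h, pow_zero]

variable (cs : CoxeterSystem M W)

theorem simple_commute {i j : B} (hij : M i j = 2) :
    cs.simple i * cs.simple j = cs.simple j * cs.simple i := by
  have h := cs.simple_mul_simple_pow i j
  rw [hij, pow_two, mul_eq_one_iff_eq_inv] at h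
  simpa using h

theorem simple_commute_of_ne_zero (hra : M.IsRightAngled) {i j : B} (hij : M i j ≠ 0) :
    cs.simple i * cs.simple j = cs.simple j * cs.simple i := by
  by_cases h : i = j
  · rw [h]
  · exact cs.simple_commute ((hra i j h).resolve_right hij)

theorem simple_mul_wordProd_comm (hra : M.IsRightAngled) {t : B} {β : List B}
    (hβ : ∀ b ∈ β, M t b ≠ 0) :
    cs.simple t * cs.wordProd β = cs.wordProd β * cs.simple t := by
  induction β with
  | nil => simp
  | cons b β ih =>
    rw [wordProd_cons, ← mul_assoc, cs.simple_commute_of_ne_zero hra (hβ b (by simp)), mul_assoc,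
      ih fun c hc => hβ c (by simp [hc]), mul_assoc]

/-- The retraction of a right-angled Coxeter group onto the standard parabolic subgroup generated
by the simple reflections that commute with `t`. -/
noncomputable def starRetraction (hra : M.IsRightAngled) (t : B) : W →* W :=
  cs.lift ⟨fun b => if M t b ≠ 0 then cs.simple b else 1, hra.isLiftable
    (fun i => by split_ifs <;> simp)
    (fun i j hij => by
      have := cs.simple_commute hij
      split_ifs <;> simp [this])⟩

theorem starRetraction_simple (hra : M.IsRightAngled) (t b : B) :
    cs.starRetraction hra t (cs.simple b) = if M t b ≠ 0 then cs.simple b else 1 := by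
  simp only [starRetraction, lift_apply_simple]

theorem starRetraction_wordProd (hra : M.IsRightAngled) (t : B) (β : List B) :
    cs.starRetraction hra t (cs.wordProd β) =
      cs.wordProd (β.filter fun b => decide (M t b ≠ 0)) := by
  induction β with
  | nil => simp
  | cons b β ih =>
    rw [wordProd_cons, map_mul, ih, starRetraction_simple, List.filter_cons]
    by_cases h : M t b = 0 <;> simp [h, wordProd_cons]

theorem IsReduced.ne_zero_of_starRetraction_eq {cs : CoxeterSystem M W} (hra : M.IsRightAngled)
    {t : B} {β : List B} (hβ : cs.IsReduced β)
    (h : cs.starRetraction hra t (cs.wordProd β) = cs.wordProd β) :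
    ∀ b ∈ β, M t b ≠ 0 := by
  rw [starRetraction_wordProd] at h
  have hlen := cs.length_wordProd_le (β.filter fun b => decide (M t b ≠ 0))
  rw [h, hβ.eq] at hlen
  have := List.length_filter_eq_length_iff.mp (le_antisymm (List.length_filter_le _ _) hlen)
  simpa using this

open Classical in
/-- The action of a right-angled Coxeter group on `W × ZMod 2` whose second coordinate records the
parity of the number of crossings of the wall of `t`. -/
noncomputable def wallAction (hra : M.IsRightAngled) (t : B) : W →* Function.End (W × ZMod 2) :=
  cs.lift ⟨fun b => (fun p => (cs.simple b * p.1,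
      p.2 + if b = t ∧ cs.starRetraction hra t p.1 = p.1 then 1 else 0)), by
    have hfix : ∀ b x, M t b ≠ 0 → (cs.starRetraction hra t (cs.simple b * x) = cs.simple b * x ↔
        cs.starRetraction hra t x = x) := by
      intro b x hb
      rw [map_mul, starRetraction_simple, if_pos hb, mul_right_inj]
    refine hra.isLiftable (fun i => ?_) (fun i j hij => ?_)
    · funext p
      change (_, _) = p
      ext
      · simp
      · by_cases hi : i = t
        · subst hi
          simp only [hfix i p.1 (by simp), add_assoc, CharTwo.add_self_eq_zero, add_zero]
        · simp [hi]
    · have hc := cs.simple_commute hij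
      have hji : M j i = 2 := by rw [M.symmetric, hij]
      funext p
      change (_, _) = (_, _)
      ext
      · simp only [← mul_assoc, hc]
      · by_cases hi : i = t
        · subst hi
          simp only [hfix j p.1 (by simp [hij]), hfix i p.1 (by simp)]
          ring
        · by_cases hj : j = t
          · subst hj
            simp only [hfix i p.1 (by simp [hji]), hfix j p.1 (by simp)]
            ring
          · simp [hi, hj]⟩

open Classical in
theorem wallAction_simple (hra : M.IsRightAngled) (t b : B) (p : W × ZMod 2) :
    cs.wallAction hra t (cs.simple b) p = (cs.simple b * p.1,
      p.2 + if b = t ∧ cs.starRetraction hra t p.1 = p.1 then 1 else 0) := by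
  exact congrFun (cs.lift_apply_simple (G := Function.End (W × ZMod 2)) _ b) p

theorem wallAction_mul (hra : M.IsRightAngled) (t : B) (u v : W) (p : W × ZMod 2) :
    cs.wallAction hra t (u * v) p = cs.wallAction hra t u (cs.wallAction hra t v p) := by
  rw [map_mul]
  rfl

open Classical in
theorem wallAction_mul_simple (hra : M.IsRightAngled) (t : B) (ω : List B) (x : W) (ε : ZMod 2) :
    cs.wallAction hra t (cs.wordProd ω) (x * cs.simple t, ε + 1) =
      ((cs.wallAction hra t (cs.wordProd ω) (x, ε)).1 * cs.simple t,
        (cs.wallAction hra t (cs.wordProd ω) (x, ε)).2 + 1) := by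
  induction ω with
  | nil =>
    rw [wordProd_nil, map_one]
    rfl
  | cons b ω ih =>
    have hfix : ∀ y, cs.starRetraction hra t (y * cs.simple t) = y * cs.simple t ↔
        cs.starRetraction hra t y = y := by
      intro y
      rw [map_mul, starRetraction_simple, if_pos (by simp), mul_left_inj]
    rw [wordProd_cons, wallAction_mul, ih, wallAction_mul, wallAction_simple, wallAction_simple]
    ext
    · simp only [mul_assoc]
    · simp only [hfix]
      exact add_right_comm _ _ _

theorem wallAction_fst (hra : M.IsRightAngled) (t : B) (ω : List B) (p : W × ZMod 2) :
    (cs.wallAction hra t (cs.wordProd ω) p).1 = cs.wordProd ω * p.1 := by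
  induction ω with
  | nil =>
    rw [wordProd_nil, map_one, one_mul]
    rfl
  | cons b ω ih => rw [wordProd_cons, wallAction_mul, wallAction_simple, ih, mul_assoc]

theorem exists_eq_append_of_wallAction_ne_zero (hra : M.IsRightAngled) (t : B) (ω : List B)
    (h : (cs.wallAction hra t (cs.wordProd ω) (1, 0)).2 ≠ 0) :
    ∃ α β, ω = α ++ t :: β ∧ cs.starRetraction hra t (cs.wordProd β) = cs.wordProd β := by
  induction ω with
  | nil =>
    rw [wordProd_nil, map_one] at h
    exact absurd rfl h
  | cons b ω ih =>
    rw [wordProd_cons, wallAction_mul, wallAction_simple, wallAction_fst, mul_one] at h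
    by_cases hb : b = t ∧ cs.starRetraction hra t (cs.wordProd ω) = cs.wordProd ω
    · exact ⟨[], ω, by simp [hb.1], hb.2⟩
    · obtain ⟨α, β, rfl, hβ⟩ := ih (by simpa [hb] using h)
      exact ⟨b :: α, β, rfl, hβ⟩

theorem IsReduced.exists_commuting_suffix {cs : CoxeterSystem M W} (hra : M.IsRightAngled) {t : B}
    {ω : List B} (hω : cs.IsReduced ω)
    (h : (cs.wallAction hra t (cs.wordProd ω) (1, 0)).2 ≠ 0) :
    ∃ α β, ω = α ++ t :: β ∧ ∀ b ∈ β, M t b ≠ 0 := by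
  obtain ⟨α, β, rfl, hβ⟩ := cs.exists_eq_append_of_wallAction_ne_zero hra t ω h
  refine ⟨α, β, rfl, IsReduced.ne_zero_of_starRetraction_eq hra ?_ hβ⟩
  have := hω.drop (α ++ [t]).length
  rwa [List.append_cons α t β, List.drop_left] at this

theorem IsReduced.exists_commuting_suffix_of_isRightDescent {cs : CoxeterSystem M W}
    (hra : M.IsRightAngled) {t : B} {ω : List B} (hω : cs.IsReduced ω)
    (h : cs.IsRightDescent (cs.wordProd ω) t) :
    ∃ α β, ω = α ++ t :: β ∧ ∀ b ∈ β, M t b ≠ 0 := by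
  refine hω.exists_commuting_suffix hra fun h0 => ?_
  obtain ⟨ω', hω', hprod⟩ := cs.exists_isReduced (cs.wordProd ω * cs.simple t)
  have h1 : (cs.wallAction hra t (cs.wordProd ω') (1, 0)).2 = 1 := by
    have := cs.wallAction_mul_simple hra t ω 1 0
    rw [← hprod, wallAction_mul, wallAction_simple, if_pos (by simp)]
    simp only [one_mul, mul_one, zero_add] at this ⊢
    rw [this, h0, zero_add]
  obtain ⟨α, β, rfl, hβ⟩ := hω'.exists_commuting_suffix hra (by rw [h1]; exact one_ne_zero)
  have hw : cs.wordProd ω = cs.wordProd (α ++ β) := by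
    rw [← cs.simple_mul_simple_cancel_right (w := cs.wordProd ω) t, hprod, wordProd_append, wordProd_cons,
      cs.simple_mul_wordProd_comm hra hβ, wordProd_append]
    simp [mul_assoc]
  have hlen := cs.length_wordProd_le (α ++ β)
  have hlen' := hω'.eq
  rw [IsRightDescent, hprod] at h
  rw [← hw] at hlen
  simp only [List.length_append, List.length_cons] at hlen hlen'
  omega

open Classical in
/-- Commutation moves that shorten the part of a reduced word up to a given occurrence of `s`, while
keeping all the earlier occurrences of `s`, end in a firm prefix. -/
theorem exists_isFirm_initial_segment (hra : M.IsRightAngled) (s : B) (γ δ : List B)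
    (hω : cs.IsReduced (γ ++ s :: δ)) :
    ∃ γ' δ' : List B, cs.IsReduced (γ' ++ s :: δ') ∧
      cs.wordProd (γ' ++ s :: δ') = cs.wordProd (γ ++ s :: δ) ∧
      γ'.count s = γ.count s ∧ cs.IsFirm (cs.wordProd (γ' ++ [s])) := by
  induction hn : γ.length using Nat.strong_induction_on generalizing γ δ with
  | _ n ih =>
  subst hn
  by_cases hfirm : cs.IsFirm (cs.wordProd (γ ++ [s]))
  · exact ⟨γ, δ, hω, rfl, rfl, hfirm⟩
  have hred : cs.IsReduced (γ ++ [s]) := by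
    have := hω.take (γ ++ [s]).length
    rwa [List.append_cons γ s δ, List.take_left] at this
  have hs : cs.IsRightDescent (cs.wordProd (γ ++ [s])) s := by
    rw [IsRightDescent, hred.eq, wordProd_append, wordProd_singleton, simple_mul_simple_cancel_right]
    have := cs.length_wordProd_le γ
    simp only [List.length_append, List.length_singleton]
    omega
  obtain ⟨t, ht, hts⟩ : ∃ t, cs.IsRightDescent (cs.wordProd (γ ++ [s])) t ∧ t ≠ s := by
    by_contra! hcon
    exact hfirm ⟨s, hs, fun t ht => hcon t ht⟩
  obtain ⟨α, β, heq, hβ⟩ := hred.exists_commuting_suffix_of_isRightDescent hra ht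
  rcases List.eq_nil_or_concat β with rfl | ⟨β, b, rfl⟩
  · exact absurd (List.append_inj' heq rfl).2 (by simpa using hts.symm)
  obtain ⟨rfl, hb⟩ : γ = α ++ t :: β ∧ [s] = [b] :=
    List.append_inj' (by simpa using heq) rfl
  obtain rfl : s = b := by simpa using hb
  have hprod : cs.wordProd ((α ++ β) ++ s :: (t :: δ)) =
      cs.wordProd ((α ++ t :: β) ++ s :: δ) := by
    have hcomm := cs.simple_mul_wordProd_comm hra hβ
    simp only [wordProd_append, wordProd_cons, List.concat_eq_append, wordProd_nil, mul_one,
      mul_assoc] at hcomm ⊢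
    rw [← mul_assoc (cs.simple s) (cs.simple t), ← mul_assoc (cs.wordProd β), ← hcomm]
    simp only [mul_assoc]
  have hred' : cs.IsReduced ((α ++ β) ++ s :: (t :: δ)) := by
    have := hω.eq
    rw [IsReduced, hprod, this]
    simp only [List.length_append, List.length_cons]
    omega
  obtain ⟨γ', δ', h1, h2, h3, h4⟩ := ih (α ++ β).length (by simp) (α ++ β) (t :: δ) hred' rfl
  refine ⟨γ', δ', h1, h2.trans hprod, ?_, h4⟩
  rw [h3, List.count_append, List.count_append, List.count_cons_of_ne hts]

open Classical in
theorem IsReduced.count_le_firmness {cs : CoxeterSystem M W} (hra : M.IsRightAngled) {ω : List B}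
    (hω : cs.IsReduced ω) (s : B) : ω.count s ≤ cs.firmness (cs.wordProd ω) := by
  by_cases hs : s ∈ ω
  swap
  · simp [List.count_eq_zero_of_not_mem hs]
  obtain ⟨δ, γ, hδγ, hδ⟩ := List.eq_append_cons_of_mem (List.mem_reverse.mpr hs)
  obtain rfl : ω = γ.reverse ++ s :: δ.reverse := by
    simpa using congrArg List.reverse hδγ
  obtain ⟨γ', δ', h1, h2, h3, h4⟩ := cs.exists_isFirm_initial_segment hra s _ _ hω
  have hcount : (γ.reverse ++ s :: δ.reverse).count s ≤ γ'.length + 1 := by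
    have := List.count_le_length (a := s) (l := γ')
    rw [List.count_append, List.count_cons_self, List.count_reverse (l := δ),
      List.count_eq_zero_of_not_mem hδ]
    omega
  refine hcount.trans (le_csSup (a := γ'.length + 1) ?_ ⟨_, h1, h2, by simp, Or.inr ?_⟩)
  · refine ⟨cs.length (cs.wordProd (γ.reverse ++ s :: δ.reverse)), ?_⟩
    rintro k ⟨ζ, hζ, hprod, hk, -⟩
    rwa [← hprod, hζ.eq]
  · rwa [List.append_cons γ' s δ', show γ'.length + 1 = (γ' ++ [s]).length by simp, List.take_left]

theorem firmness_le_length (w : W) : cs.firmness w ≤ cs.length w := by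
  refine csSup_le' ?_
  rintro k ⟨ω, hω, rfl, hk, -⟩
  rwa [hω.eq]

theorem length_add_le_of_increasing (w : W) (ω : List B)
    (h : ∀ i < ω.length, cs.length (w * cs.wordProd (ω.take i)) <
      cs.length (w * cs.wordProd (ω.take (i + 1)))) :
    cs.length w + ω.length ≤ cs.length (w * cs.wordProd ω) := by
  have key : ∀ j ≤ ω.length, cs.length w + j ≤ cs.length (w * cs.wordProd (ω.take j)) := by
    intro j
    induction j with
    | zero => simp
    | succ j ih =>
      intro hj
      have := ih (by omega)
      have := h j hj
      omega
  simpa using key ω.length le_rfl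

end CoxeterSystem

/-- Lemma 2.18: for every `w` there is `k(w)` such that appending any reduced increasing
`w`-sequence of length `k(w)` strictly increases the firmness. -/
theorem firmness_lt_of_long_increasing_sequence {B W : Type*} [Group W] [Fintype B]
    {M : CoxeterMatrix B} (cs : CoxeterSystem M W) (hra : M.IsRightAngled) (w : W) :
    ∃ k : ℕ, ∀ ω : List B, ω.length = k →
      (∀ i < ω.length,
        cs.length (w * cs.wordProd (ω.take i))
          < cs.length (w * cs.wordProd (ω.take (i + 1)))) →
      cs.firmness w < cs.firmness (w * cs.wordProd ω) := by
  classical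
  refine ⟨Fintype.card B * cs.length w + 1, fun ω hω hinc => ?_⟩
  obtain ⟨s, hs⟩ : ∃ s, cs.length w < ω.count s := by
    by_contra! hcon
    have h1 : ∑ s : B, ω.count s = ω.length := by
      simpa using Multiset.sum_count_eq_card (m := (ω : Multiset B)) fun a _ => Finset.mem_univ a
    have h2 := Finset.sum_le_card_nsmul Finset.univ (fun s => ω.count s) _ fun s _ => hcon s
    rw [h1, hω, Finset.card_univ, smul_eq_mul] at h2
    omega
  obtain ⟨ζ, hζ, rfl⟩ := cs.exists_isReduced w
  have hred : cs.IsReduced (ζ ++ ω) := by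
    have h1 := cs.length_add_le_of_increasing _ ω hinc
    have h2 := cs.length_wordProd_le (ζ ++ ω)
    rw [hζ.eq, ← CoxeterSystem.wordProd_append] at h1
    rw [List.length_append] at h2
    rw [CoxeterSystem.IsReduced, List.length_append]
    exact le_antisymm h2 h1
  rw [← CoxeterSystem.wordProd_append]
  calc cs.firmness (cs.wordProd ζ) ≤ cs.length (cs.wordProd ζ) := cs.firmness_le_length _
    _ < ω.count s := hs
    _ ≤ (ζ ++ ω).count s := by rw [List.count_append]; omega
    _ ≤ cs.firmness (cs.wordProd (ζ ++ ω)) := hred.count_le_firmness hra s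
end

section
/- Let (W,S) be a right-angled Coxeter system with S finite. For every n ≥ 0 there exists d(n) ∈ ℕ, depending only on n (and on (W,S)), such that every w ∈ W with ℓ(w) > d(n) satisfies F#(w) > n. -/
open Classical in
/-- Add a letter `r` to a piling: `true` on the stack of `r`, `false` on the stacks of the
letters that do not commute with `r`. -/
noncomputable def CoxeterMatrix.push {B : Type*} (M : CoxeterMatrix B) (r : B)
    (f : B → List Bool) : B → List Bool :=
  fun v => if M r v = 2 then f v else decide (v = r) :: f v

/-- Remove a letter `r` from a piling. -/
def CoxeterMatrix.pop {B : Type*} (M : CoxeterMatrix B) (r : B)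
    (f : B → List Bool) : B → List Bool :=
  fun v => if M r v = 2 then f v else (f v).tail

/-- The piling of a word: one stack of booleans for each letter. -/
noncomputable def CoxeterMatrix.pile {B : Type*} (M : CoxeterMatrix B) :
    List B → B → List Bool
  | [] => fun _ => []
  | r :: ω => M.push r (M.pile ω)

/-- The pilings that come from a word and have no two adjacent occurrences of `true` in a stack. -/
def CoxeterMatrix.IsReducedPiling {B : Type*} (M : CoxeterMatrix B) (f : B → List Bool) : Prop :=
  (∃ ω, M.pile ω = f) ∧ ∀ v, (f v).IsChain (fun a b => a = true → b = false)

/-- Left multiplication by the letter `r` on pilings. -/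
noncomputable def CoxeterMatrix.toggle {B : Type*} (M : CoxeterMatrix B) (r : B)
    (f : B → List Bool) : B → List Bool :=
  if (f r).head? = some true then M.pop r f else M.push r f

namespace CoxeterMatrix

variable {B : Type*} {M : CoxeterMatrix B}

@[simp] theorem pop_push (r : B) (f : B → List Bool) : M.pop r (M.push r f) = f := by
  funext v
  by_cases h : M r v = 2 <;> simp [pop, push, h]

theorem push_self (r : B) (f : B → List Bool) : M.push r f r = true :: f r := by
  simp [push]

theorem push_of_eq_two {r v : B} (h : M r v = 2) (f : B → List Bool) : M.push r f v = f v := by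
  simp [push, h]

theorem pop_of_eq_two {r v : B} (h : M r v = 2) (f : B → List Bool) : M.pop r f v = f v := by
  simp [pop, h]

theorem toggle_of_eq_two {r v : B} (h : M r v = 2) (f : B → List Bool) :
    M.toggle r f v = f v := by
  unfold toggle
  split_ifs
  · exact pop_of_eq_two h f
  · exact push_of_eq_two h f

theorem push_comm {r x : B} (h : M r x = 2) (f : B → List Bool) :
    M.push x (M.push r f) = M.push r (M.push x f) := by
  funext v
  have h' : M x r = 2 := by rw [M.symmetric]; exact h
  by_cases h1 : M r v = 2 <;> by_cases h2 : M x v = 2 <;> simp only [push, h1, h2, if_true, if_false]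
  have e1 : v ≠ x := by rintro rfl; exact h1 h
  have e2 : v ≠ r := by rintro rfl; exact h2 h'
  simp [e1, e2]

theorem pile_append_cons {r : B} (a b : List B) (h : ∀ x ∈ a, M r x = 2) :
    M.pile (a ++ r :: b) = M.push r (M.pile (a ++ b)) := by
  induction a with
  | nil => rfl
  | cons x a ih =>
    simp only [List.cons_append, pile]
    rw [ih fun y hy => h y (List.mem_cons_of_mem _ hy), push_comm (h x List.mem_cons_self)]

theorem exists_of_head?_pile {r : B} {ω : List B} (h : (M.pile ω r).head? = some true) :
    ∃ a b, ω = a ++ r :: b ∧ ∀ x ∈ a, M r x = 2 := by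
  induction ω with
  | nil => simp [pile] at h
  | cons x ω ih =>
    by_cases hx : M x r = 2
    · rw [pile, push_of_eq_two hx] at h
      obtain ⟨a, b, rfl, hab⟩ := ih h
      refine ⟨x :: a, b, rfl, ?_⟩
      intro y hy
      rcases List.mem_cons.1 hy with rfl | hy
      · rw [M.symmetric]; exact hx
      · exact hab y hy
    · simp only [pile, push, hx, if_false, List.head?_cons, Option.some.injEq,
        decide_eq_true_eq] at h
      exact ⟨[], ω, by simp [h], by simp⟩

theorem IsReducedPiling.exists_eq_push {f : B → List Bool} (hf : M.IsReducedPiling f) {r : B}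
    (h : (f r).head? = some true) :
    ∃ g, M.IsReducedPiling g ∧ (g r).head? ≠ some true ∧ f = M.push r g := by
  obtain ⟨⟨ω, rfl⟩, hc⟩ := hf
  obtain ⟨a, b, rfl, hab⟩ := exists_of_head?_pile h
  rw [pile_append_cons a b hab] at hc ⊢
  refine ⟨_, ⟨⟨a ++ b, rfl⟩, ?_⟩, ?_, rfl⟩
  · intro v
    have hv := (hc v)
    by_cases h2 : M r v = 2
    · rwa [push_of_eq_two h2] at hv
    · simp only [push, h2, if_false] at hv
      exact hv.tail
  · have hr := hc r
    rw [push_self] at hr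
    intro hh
    obtain ⟨l, hl⟩ : ∃ l, M.pile (a ++ b) r = true :: l := by
      cases hp : M.pile (a ++ b) r with
      | nil => simp [hp] at hh
      | cons c l => simp [hp] at hh; exact ⟨l, by rw [hh]⟩
    rw [hl] at hr
    simp at hr

theorem IsReducedPiling.push {f : B → List Bool} (hf : M.IsReducedPiling f) {r : B}
    (h : (f r).head? ≠ some true) : M.IsReducedPiling (M.push r f) := by
  obtain ⟨⟨ω, hω⟩, hc⟩ := hf
  refine ⟨⟨r :: ω, by rw [pile, hω]⟩, fun v => ?_⟩
  by_cases h2 : M r v = 2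
  · rw [push_of_eq_two h2]; exact hc v
  · simp only [CoxeterMatrix.push, h2, if_false]
    have := hc v
    cases hl : f v with
    | nil => simp
    | cons c l =>
      rw [hl] at this
      refine List.isChain_cons_cons.2 ⟨?_, this⟩
      intro hv
      have hv : v = r := by simpa using hv
      subst hv
      simpa [hl] using h

@[simp] theorem toggle_push (r : B) (f : B → List Bool) : M.toggle r (M.push r f) = f := by
  simp [toggle, push_self]

theorem toggle_of_head? {r : B} {f : B → List Bool} (h : (f r).head? ≠ some true) :
    M.toggle r f = M.push r f := by
  simp [toggle, h]

theorem IsReducedPiling.toggle {f : B → List Bool} (hf : M.IsReducedPiling f) (r : B) :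
    M.IsReducedPiling (M.toggle r f) := by
  by_cases h : (f r).head? = some true
  · obtain ⟨g, hg, -, rfl⟩ := hf.exists_eq_push h
    rwa [toggle_push]
  · rw [toggle_of_head? h]
    exact hf.push h

theorem IsReducedPiling.toggle_toggle {f : B → List Bool} (hf : M.IsReducedPiling f) (r : B) :
    M.toggle r (M.toggle r f) = f := by
  by_cases h : (f r).head? = some true
  · obtain ⟨g, hg, hgr, rfl⟩ := hf.exists_eq_push h
    rw [toggle_push, toggle_of_head? hgr]
  · rw [toggle_of_head? h, toggle_push]

theorem IsReducedPiling.toggle_comm {f : B → List Bool} (hf : M.IsReducedPiling f) {r t : B}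
    (h : M r t = 2) : M.toggle r (M.toggle t f) = M.toggle t (M.toggle r f) := by
  have h' : M t r = 2 := by rw [M.symmetric]; exact h
  have key : ∀ {g : B → List Bool} {r t : B}, M r t = 2 → M.IsReducedPiling g →
      (g r).head? ≠ some true →
      M.toggle t (M.push r g) = M.push r (M.toggle t g) := by
    intro g r t h hg hr
    by_cases ht : (g t).head? = some true
    · obtain ⟨k, hk, hkt, rfl⟩ := hg.exists_eq_push ht
      rw [← push_comm h, toggle_push, toggle_push]
    · rw [toggle_of_head? ht, toggle_of_head? (by rwa [push_of_eq_two h]), push_comm h]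
  by_cases hr : (f r).head? = some true
  · obtain ⟨g, hg, hgr, rfl⟩ := hf.exists_eq_push hr
    rw [key h hg hgr, toggle_push, toggle_push]
  · rw [toggle_of_head? hr, key h hf hr, toggle_of_head?]
    rwa [toggle_of_eq_two h']

/-- The operation `toggle` as a self-map of the set of reduced pilings. -/
noncomputable def toggleEnd (M : CoxeterMatrix B) (r : B) : Function.End {f // M.IsReducedPiling f} :=
  fun f => ⟨M.toggle r f.1, f.2.toggle r⟩

theorem IsRightAngled.isLiftable_toggleEnd (hra : M.IsRightAngled) :
    M.IsLiftable M.toggleEnd := by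
  intro i j
  have hsq : ∀ (k : B) f, M.toggleEnd k (M.toggleEnd k f) = f :=
    fun k f => Subtype.ext (f.2.toggle_toggle k)
  by_cases hij : i = j
  · subst hij
    rw [M.diagonal, pow_one]
    exact funext (hsq i)
  · rcases hra i j hij with h | h
    · rw [h]
      funext f
      have hc : M.toggleEnd i (M.toggleEnd j f) = M.toggleEnd j (M.toggleEnd i f) :=
        Subtype.ext (f.2.toggle_comm h)
      change M.toggleEnd i (M.toggleEnd j (M.toggleEnd i (M.toggleEnd j f))) = f
      rw [hc, hsq, hsq]
    · rw [h, pow_zero]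

end CoxeterMatrix

namespace CoxeterSystem

variable {B W : Type*} [Group W] {M : CoxeterMatrix B} (cs : CoxeterSystem M W)

theorem simple_mul_comm_of_eq_two {r x : B} (h : M r x = 2) :
    cs.simple r * cs.simple x = cs.simple x * cs.simple r := by
  have := cs.simple_mul_simple_pow r x
  rw [h, pow_two] at this
  have := eq_inv_of_mul_eq_one_left this
  simpa using this

theorem wordProd_append_cons_of_eq_two {r : B} (a b : List B) (h : ∀ x ∈ a, M r x = 2) :
    cs.wordProd (a ++ r :: b) = cs.simple r * cs.wordProd (a ++ b) := by
  induction a with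
  | nil => simp [wordProd_cons]
  | cons x a ih =>
    simp only [List.cons_append, wordProd_cons]
    rw [ih fun y hy => h y (List.mem_cons_of_mem _ hy), ← mul_assoc, ← mul_assoc,
      cs.simple_mul_comm_of_eq_two (h x List.mem_cons_self)]

/-- The action of a right-angled Coxeter group on reduced pilings. -/
noncomputable def pilingAction (hra : M.IsRightAngled) :
    W →* Function.End {f // M.IsReducedPiling f} :=
  cs.lift ⟨M.toggleEnd, hra.isLiftable_toggleEnd⟩

theorem pilingAction_simple (hra : M.IsRightAngled) (r : B) :
    cs.pilingAction hra (cs.simple r) = M.toggleEnd r :=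
  cs.lift_apply_simple hra.isLiftable_toggleEnd r

theorem pilingAction_wordProd (hra : M.IsRightAngled) {ω : List B} (hω : cs.IsReduced ω) :
    (cs.pilingAction hra (cs.wordProd ω) ⟨fun _ => [], ⟨[], rfl⟩, by simp⟩).1 = M.pile ω := by
  induction ω with
  | nil => rw [wordProd_nil, map_one]; rfl
  | cons r ω ih =>
    have hω' : cs.IsReduced ω := by simpa using hω.drop 1
    rw [wordProd_cons, map_mul, pilingAction_simple]
    change M.toggle r (cs.pilingAction hra (cs.wordProd ω) _).1 = _
    rw [ih hω', CoxeterMatrix.toggle_of_head?, CoxeterMatrix.pile]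
    intro h
    obtain ⟨a, b, rfl, hab⟩ := CoxeterMatrix.exists_of_head?_pile h
    have h1 := hω.eq
    rw [wordProd_cons, wordProd_append_cons_of_eq_two cs a b hab,
      simple_mul_simple_cancel_left] at h1
    have h2 := cs.length_wordProd_le (a ++ b)
    simp at h1 h2
    omega

theorem exists_eq_append_cons_of_isLeftDescent (hra : M.IsRightAngled) {ω : List B}
    (hω : cs.IsReduced ω) {r : B} (hr : cs.IsLeftDescent (cs.wordProd ω) r) :
    ∃ a b, ω = a ++ r :: b ∧ ∀ x ∈ a, M r x = 2 := by
  obtain ⟨τ, hτ, hτω⟩ := cs.exists_isReduced (cs.simple r * cs.wordProd ω)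
  have hprod : cs.wordProd (r :: τ) = cs.wordProd ω := by
    rw [wordProd_cons, ← hτω, simple_mul_simple_cancel_left]
  have hred : cs.IsReduced (r :: τ) := by
    have h1 := (cs.isLeftDescent_iff).1 hr
    rw [hτω, hτ.eq] at h1
    rw [IsReduced, hprod, ← h1, List.length_cons]
  apply CoxeterMatrix.exists_of_head?_pile
  rw [← cs.pilingAction_wordProd hra hω, ← hprod, cs.pilingAction_wordProd hra hred,
    CoxeterMatrix.pile, CoxeterMatrix.push_self]
  rfl

/-- The exchange condition in a right-angled Coxeter group: a right descent can be moved to the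
end of any reduced word by commutations. -/
theorem exists_eq_append_cons_of_isRightDescent (hra : M.IsRightAngled) {ω : List B}
    (hω : cs.IsReduced ω) {r : B} (hr : cs.IsRightDescent (cs.wordProd ω) r) :
    ∃ a b, ω = a ++ r :: b ∧ cs.wordProd ω = cs.wordProd (a ++ b ++ [r]) := by
  obtain ⟨a, b, h, hab⟩ := cs.exists_eq_append_cons_of_isLeftDescent hra (hω.reverse) (r := r)
    (by rw [wordProd_reverse, isLeftDescent_inv_iff]; exact hr)
  refine ⟨b.reverse, a.reverse, ?_, ?_⟩
  · rw [← List.reverse_inj, h]; simp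
  · rw [← inv_inj, ← wordProd_reverse, ← wordProd_reverse, h,
      wordProd_append_cons_of_eq_two cs a b hab]
    simp [wordProd_cons]

open Classical in
theorem exists_isFirm_of_lt_count (hra : M.IsRightAngled) (n : ℕ) (s : B) (ω τ : List B)
    (hred : cs.IsReduced (ω ++ τ)) (hn : n < ω.count s) :
    ∃ ω' τ', cs.IsReduced (ω' ++ τ') ∧ cs.wordProd (ω' ++ τ') = cs.wordProd (ω ++ τ) ∧
      n < ω'.count s ∧ cs.IsFirm (cs.wordProd ω') := by
  induction hm : ω.length using Nat.strong_induction_on generalizing ω τ with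
  | _ m ih =>
  have hω : cs.IsReduced ω := by simpa using hred.take ω.length
  by_cases hs : ∀ r, cs.IsRightDescent (cs.wordProd ω) r → r = s
  · refine ⟨ω, τ, hred, rfl, hn, s, ?_, hs⟩
    have hne : cs.wordProd ω ≠ 1 := by
      intro h1
      have h2 := hω.eq
      rw [h1, length_one] at h2
      have := List.count_le_length (a := s) (l := ω)
      omega
    obtain ⟨r, hr⟩ := cs.exists_rightDescent_of_ne_one hne
    exact hs r hr ▸ hr
  · push Not at hs
    obtain ⟨r, hr, hrs⟩ := hs
    obtain ⟨a, b, rfl, hab⟩ := cs.exists_eq_append_cons_of_isRightDescent hra hω hr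
    have hprod : cs.wordProd (a ++ b ++ (r :: τ)) = cs.wordProd (a ++ r :: b ++ τ) := by
      rw [wordProd_append cs (a ++ r :: b), hab, ← wordProd_append]
      simp
    have hred' : cs.IsReduced (a ++ b ++ (r :: τ)) := by
      rw [IsReduced, hprod, hred.eq]
      simp
      omega
    obtain ⟨ω', τ', h1, h2, h3⟩ := ih (a ++ b).length (by rw [← hm]; simp) (a ++ b) (r :: τ)
      hred' (by simpa [List.count_cons, hrs] using hn) rfl
    exact ⟨ω', τ', h1, h2.trans hprod, h3⟩

theorem le_firmness_s7 {ω τ : List B} (hred : cs.IsReduced (ω ++ τ))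
    (hfirm : cs.IsFirm (cs.wordProd ω)) : ω.length ≤ cs.firmness (cs.wordProd (ω ++ τ)) := by
  apply le_csSup
  · refine ⟨cs.length (cs.wordProd (ω ++ τ)), ?_⟩
    rintro k ⟨σ, hσ, hσw, hk, -⟩
    rwa [← hσw, hσ.eq]
  · exact ⟨ω ++ τ, hred, rfl, by simp, Or.inr (by simpa using hfirm)⟩

end CoxeterSystem

open Classical in
theorem List.exists_lt_count_of_mul_card_lt_length {B : Type*} [Fintype B] (n : ℕ) (ω : List B)
    (h : Fintype.card B * n < ω.length) : ∃ s, n < ω.count s := by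
  by_contra! hc
  have h1 : ∑ s : B, ω.count s = ω.length := by
    simpa using Multiset.sum_count_eq_card (s := Finset.univ) (m := (ω : Multiset B)) (by simp)
  have h2 : ∑ s : B, ω.count s ≤ ∑ _s : B, n := Finset.sum_le_sum fun s _ => hc s
  simp at h2
  omega

/-- Theorem 2.19: for every `n` there is `d(n)` such that every element of length
greater than `d(n)` has firmness greater than `n`. -/
theorem firmness_gt_of_length_gt {B W : Type*} [Group W] [Fintype B]
    {M : CoxeterMatrix B} (cs : CoxeterSystem M W) (hra : M.IsRightAngled) (n : ℕ) :
    ∃ d : ℕ, ∀ w : W, d < cs.length w → n < cs.firmness w := by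
  classical
  refine ⟨Fintype.card B * n, fun w hw => ?_⟩
  obtain ⟨ω, hω, rfl⟩ := cs.exists_isReduced w
  rw [hω.eq] at hw
  obtain ⟨s, hs⟩ := ω.exists_lt_count_of_mul_card_lt_length n hw
  obtain ⟨ω', τ', hred, hprod, hcount, hfirm⟩ :=
    cs.exists_isFirm_of_lt_count hra n s ω [] (by simpa using hω) (by convert hs)
  have h1 := cs.le_firmness_s7 hred hfirm
  rw [hprod, List.append_nil] at h1
  have h2 := List.count_le_length (a := s) (l := ω')
  omega
end
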